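/- arXiv:2111.00617 — 3 statements merged into one kernel-verified Lean document; each statement's English description precedes it below -/
import Mathlib

section
/- Let K₁ and K₂ be number fields with compositum K₁K₂. Then |disc(K₁K₂)|^{1/[K₁K₂:ℚ]} ≤ |disc(K₁)|^{1/[K₁:ℚ]} · |disc(K₂)|^{1/[K₂:ℚ]}. -/
open Module nonZeroDivisors

/-- The matrices of embeddings of a basis and of its trace dual are inverse to each other. -/
theorem Module.Basis.sum_embedding_mul_embedding_traceDual {K F E ι : Type*} [Field K] [Field F]
    [Algebra K F] [FiniteDimensional K F] [Algebra.IsSeparable K F] [Field E] [Algebra K E]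
    [IsAlgClosed E] [Fintype ι] [DecidableEq ι] [DecidableEq (F →ₐ[K] E)]
    (b : Basis ι K F) (σ τ : F →ₐ[K] E) :
    ∑ i, σ (b i) * τ (b.traceDual i) = if σ = τ then 1 else 0 := by
  have hcard : Fintype.card ι = Fintype.card (F →ₐ[K] E) := by
    rw [← Nat.card_eq_fintype_card, ← Nat.card_eq_fintype_card, ← finrank_eq_nat_card_basis b,
      Nat.card_eq_fintype_card, AlgHom.card]
  have hmul : Algebra.embeddingsMatrix K E b *
      (Algebra.embeddingsMatrix K E b.traceDual).transpose = 1 := by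
    ext i j
    simp only [Matrix.mul_apply, Matrix.transpose_apply, Algebra.embeddingsMatrix_apply, ← map_mul]
    rw [← trace_eq_sum_embeddings, mul_comm, b.trace_traceDual_mul]
    simp [Matrix.one_apply]
  have h := congr_fun₂ ((Matrix.mul_eq_one_comm_of_card_eq _ _ _ hcard).mp hmul) τ σ
  simpa [Matrix.mul_apply, Matrix.one_apply, Algebra.embeddingsMatrix_apply, mul_comm,
    eq_comm] using h

/-- If `L` is the compositum of `F₁` and `F₂`, every element of `L` is the combination of the trace
dual of a basis of `F₂` whose coefficients are its relative trace pairings with that basis. -/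
theorem IntermediateField.sum_trace_mul_traceDual {K L ι : Type*} [Field K] [Field L]
    [Algebra K L] [FiniteDimensional K L] [Algebra.IsSeparable K L] [Fintype ι] [DecidableEq ι]
    {F₁ F₂ : IntermediateField K L} (h : F₁ ⊔ F₂ = ⊤) (b : Basis ι K F₂) (x : L) :
    ∑ i, algebraMap F₁ L (Algebra.trace F₁ L (x * b i)) * b.traceDual i = x := by
  classical
  let E := AlgebraicClosure L
  apply FaithfulSMul.algebraMap_injective L E
  let f (σ : L →ₐ[F₁] E) : F₂ →ₐ[K] E := (σ.restrictScalars K).comp F₂.val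
  let g : L →ₐ[F₁] E := IsScalarTower.toAlgHom F₁ L E
  have hf (σ : L →ₐ[F₁] E) : f σ = f g ↔ σ = g := by
    refine ⟨fun hσ ↦ ?_, fun hσ ↦ hσ ▸ rfl⟩
    have h_top : (⊤ : IntermediateField K L) ≤
        (AlgHom.equalizer (σ.restrictScalars K) (g.restrictScalars K)).toIntermediateField
          (fun y hy ↦ by simpa only [AlgHom.mem_equalizer, map_inv₀] using congr_arg (·⁻¹) hy) := by
      rw [← h]
      refine sup_le (fun y hy ↦ ?_) (fun y hy ↦ ?_)
      · exact (σ.commutes ⟨y, hy⟩).trans (g.commutes ⟨y, hy⟩).symm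
      · exact DFunLike.congr_fun hσ ⟨y, hy⟩
    ext y
    exact h_top (mem_top : y ∈ ⊤)
  calc algebraMap L E (∑ i, algebraMap F₁ L (Algebra.trace F₁ L (x * b i)) * b.traceDual i)
      = ∑ i, ∑ σ : L →ₐ[F₁] E, σ x * (f σ (b i) * f g (b.traceDual i)) := by
        rw [map_sum]
        refine Finset.sum_congr rfl fun i _ ↦ ?_
        rw [map_mul, ← IsScalarTower.algebraMap_apply F₁ L E, trace_eq_sum_embeddings,
          Finset.sum_mul]
        refine Finset.sum_congr rfl fun σ _ ↦ ?_
        rw [map_mul, mul_assoc]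
        rfl
    _ = ∑ σ : L →ₐ[F₁] E, σ x * if σ = g then 1 else 0 := by
        rw [Finset.sum_comm]
        refine Finset.sum_congr rfl fun σ _ ↦ ?_
        rw [← Finset.mul_sum, b.sum_embedding_mul_embedding_traceDual]
        simp only [hf]
    _ = algebraMap L E x := by simp [g]

namespace NumberField

variable {L : Type*} [Field L] [NumberField L] {F₁ F₂ : IntermediateField ℚ L}

theorem traceDual_le_span_map_traceDual (h : F₁ ⊔ F₂ = ⊤) :
    (Submodule.traceDual (𝓞 F₁) F₁ (1 : Submodule (𝓞 L) L)).restrictScalars (𝓞 F₁) ≤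
      Submodule.span (𝓞 F₁)
        (algebraMap F₂ L '' (Submodule.traceDual ℤ ℚ (1 : Submodule (𝓞 F₂) F₂))) := by
  classical
  intro x hx
  let b := (RingOfIntegers.basis F₂).localizationLocalization ℚ ℤ⁰ F₂
  rw [← IntermediateField.sum_trace_mul_traceDual h b x]
  refine Submodule.sum_mem _ fun i _ ↦ ?_
  obtain ⟨c, hc⟩ : Algebra.trace F₁ L (x * b i) ∈ (algebraMap (𝓞 F₁) F₁).range := by
    refine Submodule.mem_traceDual.mp hx _ ?_
    rw [Submodule.mem_one]
    refine ⟨algebraMap (𝓞 F₂) (𝓞 L) (RingOfIntegers.basis F₂ i), ?_⟩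
    rw [Basis.localizationLocalization_apply]
    rfl
  rw [← hc]
  refine Submodule.smul_mem _ c (Submodule.subset_span ⟨b.traceDual i, ?_, rfl⟩)
  have := Submodule.traceDual_span_of_basis ℤ (1 : Submodule (𝓞 F₂) F₂) b
    (by rw [Basis.localizationLocalization_span ℚ ℤ⁰ F₂]; ext; simp)
  exact this.ge (Submodule.subset_span ⟨i, rfl⟩)

open FractionalIdeal in
/-- The relative different of a compositum divides the different of the other factor. -/
theorem differentIdeal_dvd_map_differentIdeal (h : F₁ ⊔ F₂ = ⊤) :
    differentIdeal (𝓞 F₁) (𝓞 L) ∣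
      (differentIdeal ℤ (𝓞 F₂)).map (algebraMap (𝓞 F₂) (𝓞 L)) := by
  rw [Ideal.dvd_iff_le, ← coeIdeal_le_coeIdeal L, coeIdeal_differentIdeal (𝓞 F₁) F₁ L (𝓞 L),
    ← extendedHom_coeIdeal_eq_map L (𝓞 L) (K := F₂), le_inv_comm _ (by simp), ← map_inv₀,
    coeIdeal_differentIdeal ℤ ℚ, inv_inv, ← coe_le_coe, coe_dual_one, coe_extendedHom_eq_span,
    ← coeToSet_coeToSubmodule, coe_dual_one]
  · have := Submodule.span_mono (R := 𝓞 L) <| traceDual_le_span_map_traceDual h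
    rwa [← Submodule.span_coe_eq_restrictScalars, Submodule.span_span_of_tower,
      Submodule.span_span_of_tower, Submodule.span_eq] at this
  · exact (_root_.map_ne_zero _).mpr <| coeIdeal_eq_zero.not.mpr differentIdeal_ne_bot

theorem natAbs_discr_dvd (h : F₁ ⊔ F₂ = ⊤) :
    (discr L).natAbs ∣ (discr F₁).natAbs ^ finrank F₁ L * (discr F₂).natAbs ^ finrank F₂ L := by
  rw [natAbs_discr_eq_absNorm_differentIdeal_mul_natAbs_discr_pow F₁ (𝓞 F₁) L (𝓞 L), mul_comm]
  refine mul_dvd_mul_left _ ?_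
  have hdvd := map_dvd Ideal.absNorm (differentIdeal_dvd_map_differentIdeal h)
  let _ : Algebra (FractionRing (𝓞 F₂)) (FractionRing (𝓞 L)) := FractionRing.liftAlgebra _ _
  rwa [Ideal.absNorm_algebraMap, absNorm_differentIdeal F₂,
    ← IsFractionRing.finrank_eq (𝓞 F₂) F₂ (𝓞 L) L] at hdvd

theorem rootDiscr_le_of_sup_eq_top (h : F₁ ⊔ F₂ = ⊤) :
    (|discr L| : ℝ) ^ ((1 : ℝ) / finrank ℚ L) ≤
      (|discr F₁| : ℝ) ^ ((1 : ℝ) / finrank ℚ F₁) *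
        (|discr F₂| : ℝ) ^ ((1 : ℝ) / finrank ℚ F₂) := by
  have root_eq (F : IntermediateField ℚ L) : (|discr F| : ℝ) ^ ((1 : ℝ) / finrank ℚ F) =
      ((|discr F| : ℝ) ^ finrank F L) ^ ((1 : ℝ) / finrank ℚ L) := by
    rw [← Real.rpow_natCast, ← Real.rpow_mul (by positivity), ← finrank_mul_finrank ℚ F L]
    have : (finrank F L : ℝ) ≠ 0 := Nat.cast_ne_zero.mpr finrank_pos.ne'
    have : (finrank ℚ F : ℝ) ≠ 0 := Nat.cast_ne_zero.mpr finrank_pos.ne'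
    congr 1
    push_cast
    field_simp
  rw [root_eq F₁, root_eq F₂, ← Real.mul_rpow (by positivity) (by positivity)]
  refine Real.rpow_le_rpow (by positivity) ?_ (by positivity)
  have hle := Nat.le_of_dvd (Nat.pos_of_ne_zero (mul_ne_zero
    (pow_ne_zero _ (Int.natAbs_ne_zero.mpr (discr_ne_zero _)))
    (pow_ne_zero _ (Int.natAbs_ne_zero.mpr (discr_ne_zero _))))) (natAbs_discr_dvd h)
  have := (Nat.cast_le (α := ℝ)).mpr hle
  simpa only [Nat.cast_mul, Nat.cast_pow, Nat.cast_natAbs, Int.cast_abs] using this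

end NumberField

/-- Let `K₁`, `K₂` be number fields (inside `ℂ`) with compositum `K₁K₂ = K₁ ⊔ K₂`. Then
`|disc(K₁K₂)|^(1/[K₁K₂:ℚ]) ≤ |disc(K₁)|^(1/[K₁:ℚ]) * |disc(K₂)|^(1/[K₂:ℚ])`. -/
theorem rootDiscr_compositum_le (K₁ K₂ : IntermediateField ℚ ℂ)
    [NumberField K₁] [NumberField K₂] :
    haveI : NumberField ↥(K₁ ⊔ K₂) := ⟨⟩
    (|NumberField.discr ↥(K₁ ⊔ K₂)| : ℝ) ^
        ((1 : ℝ) / (Module.finrank ℚ ↥(K₁ ⊔ K₂) : ℝ)) ≤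
      (|NumberField.discr K₁| : ℝ) ^ ((1 : ℝ) / (Module.finrank ℚ K₁ : ℝ)) *
        (|NumberField.discr K₂| : ℝ) ^ ((1 : ℝ) / (Module.finrank ℚ K₂ : ℝ)) := by
  let _ : NumberField ↥(K₁ ⊔ K₂) := ⟨⟩
  have h₁ : K₁ ≤ K₁ ⊔ K₂ := le_sup_left
  have h₂ : K₂ ≤ K₁ ⊔ K₂ := le_sup_right
  have h : IntermediateField.restrict h₁ ⊔ IntermediateField.restrict h₂ = ⊤ := by
    apply IntermediateField.lift_injective
    rw [IntermediateField.lift_sup, IntermediateField.lift_restrict,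
      IntermediateField.lift_restrict, IntermediateField.lift_top]
  have e₁ := IntermediateField.restrictAlgEquiv h₁
  have e₂ := IntermediateField.restrictAlgEquiv h₂
  rw [NumberField.discr_eq_discr_of_algEquiv _ e₁, NumberField.discr_eq_discr_of_algEquiv _ e₂,
    e₁.toLinearEquiv.finrank_eq, e₂.toLinearEquiv.finrank_eq]
  exact NumberField.rootDiscr_le_of_sup_eq_top h
end

section
/- Let K₁ and K₂ be number fields with compositum K₁K₂. Then |disc(K₁K₂)| ≤ |disc(K₁)|^{[K₂:ℚ]} · |disc(K₂)|^{[K₁:ℚ]}. -/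
open Algebra Module Submodule FractionalIdeal IntermediateField nonZeroDivisors

section Trace

variable {K F : Type*} [Field K] [Field F] [Algebra K F] [FiniteDimensional K F]
  [Algebra.IsSeparable K F] {ι : Type*} [Fintype ι] [DecidableEq ι]

/-- Orthogonality relation between the conjugates of a basis of a finite separable extension and
the conjugates of its trace dual. -/
theorem Module.Basis.sum_algHom_mul_algHom_traceDual (b : Basis ι K F) {E : Type*} [Field E]
    [IsAlgClosed E] [Algebra K E] [DecidableEq (F →ₐ[K] E)] (σ τ : F →ₐ[K] E) :
    ∑ i, σ (b i) * τ (b.traceDual i) = if σ = τ then 1 else 0 := by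
  let M : Matrix ι (F →ₐ[K] E) E := .of fun i σ ↦ σ (b i)
  let N : Matrix (F →ₐ[K] E) ι E := .of fun τ i ↦ τ (b.traceDual i)
  have e : (F →ₐ[K] E) ≃ ι := Fintype.equivOfCardEq <| by
    rw [AlgHom.card, finrank_eq_card_basis b]
  have hMN : M * N = 1 := by
    ext i j
    simp_rw [M, N, Matrix.mul_apply, Matrix.of_apply, ← map_mul]
    rw [← trace_eq_sum_embeddings E, b.trace_mul_traceDual, Matrix.one_apply,
      MonoidWithZeroHom.map_ite_one_zero]
  have hNM : N * M = 1 := (Matrix.mul_eq_one_comm_of_equiv e.symm).mp hMN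
  have := congr_fun₂ hNM τ σ
  simpa [M, N, Matrix.mul_apply, Matrix.one_apply, mul_comm, eq_comm] using this

variable {L : Type*} [Field L] [Algebra K L] [FiniteDimensional K L]
  {F₁ F₂ : IntermediateField K L} [Algebra.IsSeparable K F₂] [Algebra.IsSeparable F₁ L]

/-- If `L = F₁F₂`, then every element of `L` is recovered from its relative traces to `F₁` against
a `K`-basis of `F₂`. -/
theorem IntermediateField.sum_trace_mul_algebraMap_traceDual (b : Basis ι K F₂)
    (h : F₁ ⊔ F₂ = ⊤) (x : L) :
    ∑ i, trace F₁ L (x * algebraMap F₂ L (b i)) • algebraMap F₂ L (b.traceDual i) = x := by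
  classical
  let E := AlgebraicClosure L
  let τ : F₂ →ₐ[K] E := IsScalarTower.toAlgHom K F₂ E
  let res (σ : L →ₐ[F₁] E) : F₂ →ₐ[K] E := (σ.restrictScalars K).comp F₂.val
  have h' : F₁.toSubalgebra ⊔ F₂.toSubalgebra = ⊤ := by
    simpa [sup_toSubalgebra_of_isAlgebraic_right] using congr_arg IntermediateField.toSubalgebra h
  have hres (σ : L →ₐ[F₁] E) : res σ = τ ↔ σ = IsScalarTower.toAlgHom F₁ L E := by
    refine ⟨fun hσ ↦ ?_, fun hσ ↦ hσ ▸ rfl⟩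
    refine AlgHom.restrictScalars_injective K (AlgHom.ext_on_codisjoint
      (codisjoint_iff.mpr h') ?_ ?_)
    · exact fun y hy ↦ σ.commutes ⟨y, hy⟩
    · exact fun y hy ↦ DFunLike.congr_fun hσ ⟨y, hy⟩
  apply FaithfulSMul.algebraMap_injective L E
  have key (i : ι) : algebraMap L E
      (trace F₁ L (x * algebraMap F₂ L (b i)) • algebraMap F₂ L (b.traceDual i)) =
      ∑ σ : L →ₐ[F₁] E, σ x * (res σ (b i) * τ (b.traceDual i)) := by
    rw [Algebra.smul_def, map_mul, ← IsScalarTower.algebraMap_apply F₁ L E,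
      trace_eq_sum_embeddings E, Finset.sum_mul]
    refine Finset.sum_congr rfl fun σ _ ↦ ?_
    rw [map_mul, mul_assoc]
    rfl
  rw [map_sum, Finset.sum_congr rfl fun i _ ↦ key i, Finset.sum_comm]
  simp_rw [← Finset.mul_sum, b.sum_algHom_mul_algHom_traceDual, hres]
  simp

end Trace

section Different

variable (A B : Type*) {K L : Type*} [CommRing A] [Field K] [Algebra A K] [IsFractionRing A K]
  [CommRing B] [Field L] [Algebra B L] [Algebra A L] [Algebra K L] [FiniteDimensional K L]
  [IsScalarTower A K L]
variable (R₁ R₂ : Type*) [CommRing R₁] [CommRing R₂] [Algebra A R₂]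
  [Algebra R₁ B] [Algebra R₂ B] [Algebra R₁ L] [Algebra R₂ L]
  [IsScalarTower R₁ B L] [IsScalarTower R₂ B L] [Module.Finite A R₂]
variable {F₁ F₂ : IntermediateField K L} [Algebra R₁ F₁] [Algebra R₂ F₂]
  [IsScalarTower A R₂ F₂] [IsScalarTower R₁ F₁ L] [IsScalarTower R₂ F₂ L]
  [Algebra.IsSeparable K F₂] [Algebra.IsSeparable F₁ L]

/-- Version of `Submodule.traceDual_le_span_map_traceDual` without linear disjointness. -/
theorem Submodule.traceDual_le_span_map_traceDual_of_sup_eq_top [Module.Free A R₂]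
    [IsLocalization (Algebra.algebraMapSubmonoid R₂ A⁰) F₂] (h : F₁ ⊔ F₂ = ⊤) :
    (traceDual R₁ F₁ (1 : Submodule B L)).restrictScalars R₁ ≤
      span R₁ (algebraMap F₂ L '' (traceDual A K (1 : Submodule R₂ F₂))) := by
  classical
  intro x hx
  let b₂ := (Free.chooseBasis A R₂).localizationLocalization K A⁰ F₂
  rw [← sum_trace_mul_algebraMap_traceDual b₂ h x]
  refine sum_mem fun i _ ↦ ?_
  obtain ⟨r, hr⟩ := mem_traceDual.mp hx (algebraMap F₂ L (b₂ i)) <| by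
    rw [Basis.localizationLocalization_apply, ← IsScalarTower.algebraMap_apply,
      IsScalarTower.algebraMap_apply R₂ B L, mem_one]
    exact ⟨_, rfl⟩
  rw [traceForm_apply] at hr
  rw [← hr, algebraMap_smul]
  refine smul_mem _ _ (subset_span ⟨_, ?_, rfl⟩)
  change _ ∈ (traceDual A K (1 : Submodule R₂ F₂)).restrictScalars A
  rw [traceDual_span_of_basis A (1 : Submodule R₂ F₂) b₂
    (by rw [Basis.localizationLocalization_span K A⁰ F₂]; ext; simp)]
  exact subset_span ⟨i, rfl⟩

attribute [local instance] FractionRing.liftAlgebra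

variable [IsDomain A] [IsDedekindDomain B] [IsDedekindDomain R₁] [IsDedekindDomain R₂]
    [IsFractionRing B L] [IsFractionRing R₁ F₁] [IsFractionRing R₂ F₂] [IsIntegrallyClosed A]
    [IsIntegralClosure B R₁ L] [IsTorsionFree R₁ B] [IsTorsionFree R₂ B]

set_option linter.overlappingInstances false

/-- Version of `IsDedekindDomain.differentIdeal_dvd_map_differentIdeal` without linear
disjointness. -/
theorem IsDedekindDomain.differentIdeal_dvd_map_differentIdeal_of_sup_eq_top
    [Algebra.IsIntegral R₂ B] [Module.Free A R₂]
    [IsLocalization (Algebra.algebraMapSubmonoid R₂ A⁰) F₂] (h : F₁ ⊔ F₂ = ⊤) :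
    differentIdeal R₁ B ∣ Ideal.map (algebraMap R₂ B) (differentIdeal A R₂) := by
  have : Algebra.IsSeparable (FractionRing A) (FractionRing R₂) := by
    refine Algebra.IsSeparable.of_equiv_equiv (FractionRing.algEquiv A K).symm.toRingEquiv
          (FractionRing.algEquiv R₂ F₂).symm.toRingEquiv ?_
    ext _
    exact IsFractionRing.algEquiv_commutes (FractionRing.algEquiv A K).symm
      (FractionRing.algEquiv R₂ ↥F₂).symm _
  rw [Ideal.dvd_iff_le, ← coeIdeal_le_coeIdeal L, coeIdeal_differentIdeal R₁ F₁ L B,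
    ← extendedHom_coeIdeal_eq_map L B (K := F₂), le_inv_comm _ (by simp), ← map_inv₀,
    coeIdeal_differentIdeal A K, inv_inv, ← coe_le_coe, coe_dual_one, coe_extendedHom_eq_span,
    ← coeToSet_coeToSubmodule, coe_dual_one]
  · have := Submodule.span_mono (R := B) <|
      traceDual_le_span_map_traceDual_of_sup_eq_top A B R₁ R₂ h
    rwa [← span_coe_eq_restrictScalars, span_span_of_tower, span_span_of_tower, span_eq] at this
  · exact (_root_.map_ne_zero _).mpr <| coeIdeal_eq_zero.not.mpr differentIdeal_ne_bot

end Different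

namespace NumberField

/-- The discriminant bound for the compositum of two subfields generating a number field. -/
theorem natAbs_discr_le_of_sup_eq_top {L : Type*} [Field L] [NumberField L] [inst : Algebra ℚ L]
    (K₁ K₂ : IntermediateField ℚ L) (h : K₁ ⊔ K₂ = ⊤) :
    (discr L).natAbs ≤
      (discr K₁).natAbs ^ Module.finrank ℚ K₂ * (discr K₂).natAbs ^ Module.finrank ℚ K₁ := by
  obtain rfl : inst = DivisionRing.toRatAlgebra := Subsingleton.elim _ _
  let _ : Algebra (FractionRing (𝓞 K₁)) (FractionRing (𝓞 L)) := FractionRing.liftAlgebra _ _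
  have hrank : Module.finrank ℚ L ≤ Module.finrank ℚ K₁ * Module.finrank ℚ K₂ := by
    rw [← IntermediateField.finrank_top', ← h]
    exact IntermediateField.finrank_sup_le K₁ K₂
  have hr₁ : Module.finrank K₁ L ≤ Module.finrank ℚ K₂ := by
    rw [← Module.finrank_mul_finrank ℚ K₁ L] at hrank
    exact Nat.le_of_mul_le_mul_left hrank Module.finrank_pos
  have hr₂ : Module.finrank K₂ L ≤ Module.finrank ℚ K₁ := by
    rw [← Module.finrank_mul_finrank ℚ K₂ L, mul_comm (Module.finrank ℚ K₁)] at hrank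
    exact Nat.le_of_mul_le_mul_left hrank Module.finrank_pos
  have hd₁ : 0 < (discr K₁).natAbs := Int.natAbs_pos.mpr (discr_ne_zero K₁)
  have hd₂ : 0 < (discr K₂).natAbs := Int.natAbs_pos.mpr (discr_ne_zero K₂)
  have hdvd : Ideal.absNorm (differentIdeal (𝓞 K₂) (𝓞 L)) ∣
      (discr K₁).natAbs ^ Module.finrank K₁ L := by
    rw [← absNorm_differentIdeal K₁ (𝓞 K₁), IsFractionRing.finrank_eq (𝓞 K₁) K₁ (𝓞 L) L,
      ← Ideal.absNorm_algebraMap]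
    exact map_dvd Ideal.absNorm <|
      IsDedekindDomain.differentIdeal_dvd_map_differentIdeal_of_sup_eq_top ℤ (𝓞 L) (𝓞 K₂) (𝓞 K₁)
        (F₁ := K₂) (F₂ := K₁) (by rwa [sup_comm])
  rw [natAbs_discr_eq_absNorm_differentIdeal_mul_natAbs_discr_pow K₂ (𝓞 K₂) L (𝓞 L)]
  gcongr ?_ * ?_
  · exact (Nat.le_of_dvd (pow_pos hd₁ _) hdvd).trans (Nat.pow_le_pow_right hd₁ hr₁)
  · exact Nat.pow_le_pow_right hd₂ hr₂

end NumberField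

/-- Let `K₁`, `K₂` be number fields (inside `ℂ`) with compositum `K₁K₂ = K₁ ⊔ K₂`. Then
`|disc(K₁K₂)| ≤ |disc(K₁)|^[K₂:ℚ] * |disc(K₂)|^[K₁:ℚ]`. -/
theorem abs_discr_compositum_le (K₁ K₂ : IntermediateField ℚ ℂ)
    [NumberField K₁] [NumberField K₂] :
    haveI : NumberField ↥(K₁ ⊔ K₂) := ⟨⟩
    |NumberField.discr ↥(K₁ ⊔ K₂)| ≤
      |NumberField.discr K₁| ^ Module.finrank ℚ K₂ *
        |NumberField.discr K₂| ^ Module.finrank ℚ K₁ := by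
  have : NumberField ↥(K₁ ⊔ K₂) := ⟨⟩
  let e₁ := restrictAlgEquiv (le_sup_left : K₁ ≤ K₁ ⊔ K₂)
  let e₂ := restrictAlgEquiv (le_sup_right : K₂ ≤ K₁ ⊔ K₂)
  have h := NumberField.natAbs_discr_le_of_sup_eq_top
    (restrict (le_sup_left : K₁ ≤ K₁ ⊔ K₂)) (restrict (le_sup_right : K₂ ≤ K₁ ⊔ K₂)) <| by
      rw [← lift_inj, lift_top, lift_sup, lift_restrict le_sup_left, lift_restrict le_sup_right]
  rw [← NumberField.discr_eq_discr_of_ringEquiv _ e₁.toRingEquiv,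
    ← NumberField.discr_eq_discr_of_ringEquiv _ e₂.toRingEquiv,
    ← e₁.toLinearEquiv.finrank_eq, ← e₂.toLinearEquiv.finrank_eq] at h
  simp only [Int.abs_eq_natAbs]
  exact_mod_cast h
end

section
/- Let K be a number field of degree n with group of roots of unity μ(K) of order m, and let p₁,…,p_s be the distinct prime divisors of m. Then |disc(K(ζ_{m p₁⋯p_s}))| ≤ ((2n)⁴)^{(2n)⁴ · n} · |disc(K)|^{(2n)⁴}. -/
open Polynomial NumberField in
/-- If `L = K(x)` with `x` an `N`-th root of unity, then
`|disc L| ≤ (N ^ [K : ℚ] * |disc K|) ^ N`. -/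
theorem NumberField.natAbs_discr_le_of_pow_eq_one {K L : Type*} [Field K] [NumberField K]
    [Field L] [NumberField L] [Algebra K L] {N : ℕ} (hN : 0 < N) {x : L} (hx : x ^ N = 1)
    (hgen : IntermediateField.adjoin K {x} = ⊤) :
    (discr L).natAbs ≤ (N ^ Module.finrank ℚ K * (discr K).natAbs) ^ N := by
  have hxZ : IsIntegral ℤ x := ⟨X ^ N - 1, monic_X_pow_sub_C 1 hN.ne', by simp [hx]⟩
  let y : 𝓞 L := ⟨x, hxZ⟩
  have hy : y ^ N = 1 := RingOfIntegers.ext hx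
  have hxK : IsIntegral K x := hxZ.tower_top
  have htop : Algebra.adjoin K {algebraMap (𝓞 L) L y} = ⊤ := by
    change Algebra.adjoin K {x} = ⊤
    rw [← IntermediateField.adjoin_simple_toSubalgebra_of_isAlgebraic hxK.isAlgebraic, hgen,
      IntermediateField.top_toSubalgebra]
  have hdeg : Module.finrank K L ≤ N := by
    rw [← IntermediateField.finrank_top', ← hgen, IntermediateField.adjoin.finrank hxK]
    refine (natDegree_le_of_dvd (minpoly.dvd K x (p := X ^ N - 1) (by simp [hx]))
      (monic_X_pow_sub_C 1 hN.ne').ne_zero).trans ?_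
    exact (natDegree_X_pow_sub_C (r := (1 : K))).le
  have hmem : (N : 𝓞 L) ∈ differentIdeal (𝓞 K) (𝓞 L) := by
    have hder := aeval_derivative_mem_differentIdeal (𝓞 K) K L y htop
    have hyK : IsIntegral (𝓞 K) y := Algebra.IsIntegral.isIntegral y
    obtain ⟨q, hq⟩ : minpoly (𝓞 K) y ∣ X ^ N - 1 :=
      minpoly.isIntegrallyClosed_dvd hyK (by simp [hy])
    have h := congrArg (fun f ↦ aeval y (derivative f)) hq
    simp only [derivative_mul, derivative_X_pow, derivative_one, map_add, map_sub,
      map_mul, minpoly.aeval, map_pow, aeval_X, zero_mul, add_zero, sub_zero, map_natCast] at h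
    have h' : (N : 𝓞 L) = aeval y (derivative (minpoly (𝓞 K) y)) * (aeval y q * y) := by
      rw [← mul_assoc, ← h, mul_assoc, ← pow_succ, Nat.sub_add_cancel hN, hy, mul_one]
    rw [h']
    exact Ideal.mul_mem_right _ _ hder
  have hnorm : Ideal.absNorm (differentIdeal (𝓞 K) (𝓞 L)) ≤ N ^ Module.finrank ℚ L := by
    refine Nat.le_of_dvd (pow_pos hN _) ?_
    have h := Ideal.absNorm_dvd_norm_of_mem hmem
    rw [← map_natCast (algebraMap ℤ (𝓞 L)), Algebra.norm_algebraMap, RingOfIntegers.rank] at h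
    exact_mod_cast h
  calc (discr L).natAbs
      = Ideal.absNorm (differentIdeal (𝓞 K) (𝓞 L)) *
          (discr K).natAbs ^ Module.finrank K L :=
        natAbs_discr_eq_absNorm_differentIdeal_mul_natAbs_discr_pow K (𝓞 K) L (𝓞 L)
    _ ≤ N ^ Module.finrank ℚ L * (discr K).natAbs ^ Module.finrank K L := by gcongr
    _ = (N ^ Module.finrank ℚ K * (discr K).natAbs) ^ Module.finrank K L := by
        rw [mul_pow, ← pow_mul, Module.finrank_mul_finrank]
    _ ≤ (N ^ Module.finrank ℚ K * (discr K).natAbs) ^ N :=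
        Nat.pow_le_pow_right (Nat.mul_pos (pow_pos hN _)
          (Int.natAbs_pos.mpr (discr_ne_zero K))) hdeg

theorem Nat.le_totient_sq_mul_gcd_two (m : ℕ) : m ≤ m.totient ^ 2 * m.gcd 2 := by
  induction m using Nat.recOnPrimeCoprime with
  | zero => simp
  | prime_pow p k hp =>
    rcases k with _ | k
    · simp
    rw [Nat.totient_prime_pow_succ hp]
    have hpk : p ^ k ≤ (p ^ k) ^ 2 := Nat.le_self_pow two_ne_zero _
    suffices p ≤ (p - 1) ^ 2 * (p ^ (k + 1)).gcd 2 by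
      calc p ^ (k + 1) = p ^ k * p := pow_succ _ _
        _ ≤ (p ^ k) ^ 2 * ((p - 1) ^ 2 * (p ^ (k + 1)).gcd 2) := Nat.mul_le_mul hpk this
        _ = _ := by ring
    rcases hp.eq_two_or_odd' with rfl | hodd
    · rw [Nat.gcd_eq_right (dvd_pow_self 2 k.succ_ne_zero)]
      norm_num
    · rw [(Nat.coprime_two_right.mpr hodd.pow).gcd_eq_one, mul_one]
      obtain ⟨a, rfl⟩ := hodd
      have : 1 ≤ a := by have := hp.one_lt; lia
      rw [Nat.add_sub_cancel]
      nlinarith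
  | coprime a b _ _ hab iha ihb =>
    rw [Nat.totient_mul hab, Nat.gcd_comm, hab.gcd_mul, Nat.gcd_comm 2, Nat.gcd_comm 2]
    calc a * b ≤ _ := Nat.mul_le_mul iha ihb
      _ = _ := by ring

theorem IsPrimitiveRoot.totient_le_finrank {K : Type*} [Field K] [NumberField K] {m : ℕ} {μ : K}
    (hμ : IsPrimitiveRoot μ m) : m.totient ≤ Module.finrank ℚ K := by
  rcases m.eq_zero_or_pos with rfl | hm
  · simp
  refine hμ.totient_le_degree_minpoly.trans ?_
  rw [← (minpoly.monic (hμ.isIntegral hm)).natDegree_map (algebraMap ℤ ℚ),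
    ← minpoly.isIntegrallyClosed_eq_field_fractions' ℚ (hμ.isIntegral hm)]
  exact minpoly.natDegree_le μ

/-- A number field of degree `n` has at most `(2n)²` roots of unity. -/
theorem NumberField.card_torsion_units_le (K : Type*) [Field K] [NumberField K] :
    Nat.card (CommGroup.torsion Kˣ) ≤ (2 * Module.finrank ℚ K) ^ 2 := by
  set m := Nat.card (CommGroup.torsion Kˣ) with hm
  rcases m.eq_zero_or_pos with h0 | hpos
  · simp [h0]
  have : Finite (CommGroup.torsion Kˣ) := Nat.finite_of_card_ne_zero (hm ▸ hpos.ne')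
  obtain ⟨g, hg⟩ := IsCyclic.exists_ofOrder_eq_natCard (α := CommGroup.torsion Kˣ)
  have hprim : IsPrimitiveRoot ((g : Kˣ) : K) m := by
    rw [IsPrimitiveRoot.coe_units_iff, IsPrimitiveRoot.coe_submonoidClass_iff, hm, ← hg]
    exact IsPrimitiveRoot.orderOf g
  have h1 := hprim.totient_le_finrank
  have h2 : m.gcd 2 ≤ 4 := (Nat.gcd_le_right m two_pos).trans (by norm_num)
  calc m ≤ m.totient ^ 2 * m.gcd 2 := m.le_totient_sq_mul_gcd_two
    _ ≤ Module.finrank ℚ K ^ 2 * 4 := by gcongr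
    _ = _ := by ring


open IntermediateField in
/-- Let `K` be a number field of degree `n` whose group of roots of unity has order `m`,
and let `p₁, …, p_s` be the distinct prime divisors of `m`. Then
`|disc(K(ζ_{m p₁⋯p_s}))| ≤ ((2n)⁴)^((2n)⁴ · n) · |disc(K)|^((2n)⁴)`. -/
theorem abs_discr_adjoin_rootsOfUnity_le (K : IntermediateField ℚ ℂ) [NumberField K]
    (n m N : ℕ) (hn : n = Module.finrank ℚ K)
    (hm : m = Nat.card (CommGroup.torsion (↥K)ˣ))
    (hN : N = m * ∏ p ∈ m.primeFactors, p)
    (ζ : ℂ) (hζ : IsPrimitiveRoot ζ N) (hN0 : 0 < N) :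
    haveI : FiniteDimensional ℚ ↥(adjoin ℚ ({ζ} : Set ℂ)) :=
      IntermediateField.adjoin.finiteDimensional
        ((hζ.isIntegral hN0).tower_top (A := ℚ))
    haveI : NumberField ↥(K ⊔ adjoin ℚ ({ζ} : Set ℂ)) := ⟨⟩
    |NumberField.discr ↥(K ⊔ adjoin ℚ ({ζ} : Set ℂ))| ≤
      (((2 * n) ^ 4 : ℕ) : ℤ) ^ ((2 * n) ^ 4 * n) *
        |NumberField.discr K| ^ ((2 * n) ^ 4) := by
  have : FiniteDimensional ℚ ↥(adjoin ℚ ({ζ} : Set ℂ)) :=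
    IntermediateField.adjoin.finiteDimensional ((hζ.isIntegral hN0).tower_top (A := ℚ))
  have : NumberField ↥(K ⊔ adjoin ℚ ({ζ} : Set ℂ)) := ⟨⟩
  let L := K ⊔ adjoin ℚ ({ζ} : Set ℂ)
  let : Algebra K L := (IntermediateField.inclusion (le_sup_left : K ≤ L)).toRingHom.toAlgebra
  let x : L := ⟨ζ, (le_sup_right : adjoin ℚ {ζ} ≤ L) (mem_adjoin_simple_self ℚ ζ)⟩
  have hx : x ^ N = 1 := Subtype.ext hζ.pow_eq_one
  have hgen : IntermediateField.adjoin K {x} = ⊤ := by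
    let T := (IntermediateField.adjoin K {x}).restrictScalars ℚ
    have hle : L ≤ IntermediateField.lift T := by
      refine sup_le (fun y hy ↦ ?_) (adjoin_simple_le_iff.mpr ?_)
      · exact ⟨_, (IntermediateField.adjoin K {x}).algebraMap_mem ⟨y, hy⟩, rfl⟩
      · exact ⟨x, mem_adjoin_simple_self K x, rfl⟩
    refine eq_top_iff.mpr fun z _ ↦ ?_
    exact (IntermediateField.mem_lift (F := L) (E := T) z).mp (hle z.2)
  have hNle : N ≤ (2 * n) ^ 4 := by
    have hmn : m ≤ (2 * n) ^ 2 := hm ▸ hn ▸ NumberField.card_torsion_units_le K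
    have hm0 : 0 < m := Nat.pos_of_ne_zero (by rintro rfl; simp [hN] at hN0)
    calc N = m * ∏ p ∈ m.primeFactors, p := hN
      _ ≤ (2 * n) ^ 2 * (2 * n) ^ 2 :=
        Nat.mul_le_mul hmn ((Nat.le_of_dvd hm0 m.prod_primeFactors_dvd).trans hmn)
      _ = (2 * n) ^ 4 := by ring
  have hmain := NumberField.natAbs_discr_le_of_pow_eq_one hN0 hx hgen
  rw [← hn] at hmain
  have hdpos : 0 < (NumberField.discr K).natAbs := Int.natAbs_pos.mpr (NumberField.discr_ne_zero K)
  have hbound : (NumberField.discr L).natAbs ≤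
      ((2 * n) ^ 4) ^ ((2 * n) ^ 4 * n) * (NumberField.discr K).natAbs ^ ((2 * n) ^ 4) :=
    calc (NumberField.discr L).natAbs
        ≤ (N ^ n * (NumberField.discr K).natAbs) ^ N := hmain
      _ ≤ (N ^ n * (NumberField.discr K).natAbs) ^ ((2 * n) ^ 4) :=
        Nat.pow_le_pow_right (Nat.mul_pos (pow_pos hN0 _) hdpos) hNle
      _ ≤ (((2 * n) ^ 4) ^ n * (NumberField.discr K).natAbs) ^ ((2 * n) ^ 4) := by gcongr
      _ = _ := by rw [mul_pow, ← pow_mul _ n, mul_comm n]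
  rw [Int.abs_eq_natAbs, Int.abs_eq_natAbs]
  exact_mod_cast hbound
end
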